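/- arXiv:2011.08476 — 2 statements merged into one kernel-verified Lean document; each statement's English description precedes it below -/
import Mathlib

section
/- Let ℓ be a prime, G̃ a finite group, and π : G̃ → H a surjective group homomorphism whose kernel is contained in the center of G̃. Then the map R̃ ↦ π(R̃) is a bijection from the set of ℓ-radical subgroups of G̃ onto the set of ℓ-radical subgroups of H, whose inverse sends an ℓ-radical subgroup R of H to the unique Sylow ℓ-subgroup O_ℓ(π⁻¹(R)) of the (nilpotent) group π⁻¹(R); moreover this bijection induces a bijection between conjugacy classes of ℓ-radical subgroups of G̃ and of H. -/
/-- An `ℓ`-radical subgroup of a group `G`: an `ℓ`-subgroup `R` such that `R = O_ℓ(N_G(R))`,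
i.e. every normal `ℓ`-subgroup of the normalizer `N_G(R)` is contained in `R`. -/
def IsRadicalPSubgroup (ℓ : ℕ) {G : Type*} [Group G] (R : Subgroup G) : Prop :=
  IsPGroup ℓ R ∧
    ∀ P : Subgroup G, P ≤ Subgroup.normalizer (R : Set G) → IsPGroup ℓ P →
      (∀ n ∈ Subgroup.normalizer (R : Set G), ∀ p ∈ P, n * p * n⁻¹ ∈ P) → P ≤ R

/-- `S` is the largest `ℓ`-subgroup of the preimage of `R`, and maps onto `R`. -/
def IsBigLift (ℓ : ℕ) {G H : Type*} [Group G] [Group H] (π : G →* H)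
    (S : Subgroup G) (R : Subgroup H) : Prop :=
  IsPGroup ℓ S ∧ S.map π = R ∧ ∀ P : Subgroup G, P ≤ R.comap π → IsPGroup ℓ P → P ≤ S

theorem exists_bigLift {ℓ : ℕ} (hℓ : ℓ.Prime)
    {G H : Type*} [Group G] [Finite G] [Group H]
    (π : G →* H) (hsurj : Function.Surjective π) (hker : π.ker ≤ Subgroup.center G)
    (R : Subgroup H) (hR : IsPGroup ℓ R) : ∃ S : Subgroup G, IsBigLift ℓ π S R := by
  have : Fact ℓ.Prime := ⟨hℓ⟩
  have : Finite H := Finite.of_surjective π hsurj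
  let f : R.comap π →* R := π.subgroupComap R
  have hf : Function.Surjective f := π.subgroupComap_surjective_of_surjective R hsurj
  have hfk : f.ker ≤ Subgroup.center (R.comap π) := by
    intro x hx
    have h1 : (x : G) ∈ π.ker := by
      rw [MonoidHom.mem_ker] at hx ⊢
      exact congrArg Subtype.val hx
    rw [Subgroup.mem_center_iff]
    intro y
    exact Subtype.ext (Subgroup.mem_center_iff.1 (hker h1) y)
  have : Group.IsNilpotent R := hR.isNilpotent
  have : Group.IsNilpotent (R.comap π) := Subgroup.isNilpotent_of_ker_le_center f hfk
  let P : Sylow ℓ (R.comap π) := default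
  have hPn : (P : Subgroup (R.comap π)).Normal :=
    ((Group.isNilpotent_of_finite_tfae (G := R.comap π)).out 0 3 :).1 ‹_› ℓ ‹_› P
  refine ⟨(P : Subgroup (R.comap π)).map (R.comap π).subtype, P.2.map _, ?_, ?_⟩
  · have h1 : (P : Subgroup (R.comap π)).map f = ⊤ := by
      have h2 := (P.mapSurjective hf).3 (Q := ⊤) (hR.of_equiv Subgroup.topEquiv.symm) le_top
      rw [← Sylow.coe_mapSurjective]
      exact h2.symm
    apply le_antisymm
    · rintro _ ⟨_, ⟨x, _, rfl⟩, rfl⟩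
      exact x.2
    · intro r hr
      have h3 : (⟨r, hr⟩ : R) ∈ (P : Subgroup (R.comap π)).map f := by rw [h1]; trivial
      obtain ⟨x, hx, hxr⟩ := h3
      exact ⟨x, ⟨x, hx, rfl⟩, congrArg Subtype.val hxr⟩
  · intro Q hQ hQp
    have h4 : IsPGroup ℓ (Q.subgroupOf (R.comap π)) :=
      hQp.of_equiv (Subgroup.subgroupOfEquivOfLe hQ).symm
    obtain ⟨P', hP'⟩ := h4.exists_le_sylow
    have := Sylow.unique_of_normal P hPn
    rw [Subsingleton.elim P' P] at hP'
    intro q hq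
    exact ⟨⟨q, hQ hq⟩, hP' hq, rfl⟩

theorem IsBigLift.conj_mem {ℓ : ℕ} {G H : Type*} [Group G] [Group H] {π : G →* H}
    {S S' : Subgroup G} {R R' : Subgroup H} (hS : IsBigLift ℓ π S R) (hS' : IsBigLift ℓ π S' R')
    (g : G) (hg : ∀ r ∈ R, π g * r * (π g)⁻¹ ∈ R') : ∀ s ∈ S, g * s * g⁻¹ ∈ S' := by
  intro s hs
  refine hS'.2.2 (S.map (MulAut.conj g).toMonoidHom) ?_ (hS.1.map _) ⟨s, hs, by simp⟩
  rintro _ ⟨t, ht, rfl⟩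
  have := hg (π t) (hS.2.1 ▸ ⟨t, ht, rfl⟩)
  simpa using this

theorem mem_normalizer_of_conj {G : Type*} [Group G] (R : Subgroup G) (g : G)
    (h1 : ∀ r ∈ R, g * r * g⁻¹ ∈ R) (h2 : ∀ r ∈ R, g⁻¹ * r * g ∈ R) :
    g ∈ Subgroup.normalizer (R : Set G) := by
  rw [Subgroup.mem_normalizer_iff]
  intro x
  refine ⟨h1 x, fun h => ?_⟩
  have := h2 _ h
  simpa [mul_assoc] using this

theorem conj_mem_of_normalizer {G : Type*} [Group G] {R : Subgroup G} {g : G}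
    (hg : g ∈ Subgroup.normalizer (R : Set G)) : ∀ r ∈ R, g * r * g⁻¹ ∈ R :=
  fun r hr => (Subgroup.mem_normalizer_iff.1 hg r).1 hr

theorem map_mem_normalizer {G H : Type*} [Group G] [Group H] (π : G →* H)
    {S : Subgroup G} {g : G} (hg : g ∈ Subgroup.normalizer (S : Set G)) :
    π g ∈ Subgroup.normalizer (S.map π : Set H) := by
  apply mem_normalizer_of_conj
  · rintro _ ⟨s, hs, rfl⟩
    exact ⟨_, conj_mem_of_normalizer hg s hs, by simp⟩
  · rintro _ ⟨s, hs, rfl⟩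
    exact ⟨_, conj_mem_of_normalizer (inv_mem hg) s hs, by simp⟩

theorem IsBigLift.mem_normalizer {ℓ : ℕ} {G H : Type*} [Group G] [Group H] {π : G →* H}
    {S : Subgroup G} {R : Subgroup H} (hS : IsBigLift ℓ π S R) {g : G}
    (hg : π g ∈ Subgroup.normalizer (R : Set H)) : g ∈ Subgroup.normalizer (S : Set G) := by
  apply mem_normalizer_of_conj
  · exact hS.conj_mem hS g (conj_mem_of_normalizer hg)
  · have := hS.conj_mem hS g⁻¹ (by
      rw [map_inv]; exact conj_mem_of_normalizer (inv_mem hg))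
    simpa using this

/-- A radical subgroup is the largest `ℓ`-subgroup of the preimage of its image. -/
theorem IsRadicalPSubgroup.bigLift {ℓ : ℕ} (hℓ : ℓ.Prime)
    {G H : Type*} [Group G] [Finite G] [Group H]
    (π : G →* H) (hsurj : Function.Surjective π) (hker : π.ker ≤ Subgroup.center G)
    {R : Subgroup G} (hR : IsRadicalPSubgroup ℓ R) : IsBigLift ℓ π R (R.map π) := by
  obtain ⟨S, hS⟩ := exists_bigLift hℓ π hsurj hker (R.map π) (hR.1.map π)
  have h1 : R ≤ S := hS.2.2 R (Subgroup.le_comap_map π R) hR.1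
  have key : ∀ s ∈ S, ∀ r ∈ R, s * r * s⁻¹ ∈ R := by
    intro s hs r hr
    have : π s ∈ R.map π := hS.2.1 ▸ ⟨s, hs, rfl⟩
    obtain ⟨t, ht, hts⟩ := this
    have hz : t⁻¹ * s ∈ π.ker := by rw [MonoidHom.mem_ker]; simp [hts]
    have hc := Subgroup.mem_center_iff.1 (hker hz) r
    have h2 : s * r * s⁻¹ = t * r * t⁻¹ := by
      have : s = t * (t⁻¹ * s) := by group
      calc s * r * s⁻¹ = t * ((t⁻¹ * s) * r) * s⁻¹ := by group
        _ = t * (r * (t⁻¹ * s)) * s⁻¹ := by rw [hc]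
        _ = t * r * t⁻¹ := by group
    rw [h2]
    exact mul_mem (mul_mem ht hr) (inv_mem ht)
  have h2 : S ≤ R := by
    refine hR.2 S ?_ hS.1 ?_
    · intro s hs
      refine mem_normalizer_of_conj R s (key s hs) ?_
      simpa using key s⁻¹ (inv_mem hs)
    · intro n hn
      exact conj_mem_of_normalizer (hS.mem_normalizer (map_mem_normalizer π hn))
  have h3 := le_antisymm h2 h1
  subst h3
  exact hS

theorem IsRadicalPSubgroup.map_radical {ℓ : ℕ} (hℓ : ℓ.Prime)
    {G H : Type*} [Group G] [Finite G] [Group H]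
    (π : G →* H) (hsurj : Function.Surjective π) (hker : π.ker ≤ Subgroup.center G)
    {R : Subgroup G} (hR : IsRadicalPSubgroup ℓ R) : IsRadicalPSubgroup ℓ (R.map π) := by
  have hb := hR.bigLift hℓ π hsurj hker
  refine ⟨hR.1.map π, fun P hPN hP hn => ?_⟩
  obtain ⟨S, hS⟩ := exists_bigLift hℓ π hsurj hker P hP
  have h1 : S ≤ R := by
    refine hR.2 S ?_ hS.1 ?_
    · intro s hs
      exact hb.mem_normalizer (hPN (hS.2.1 ▸ ⟨s, hs, rfl⟩))
    · intro n hnn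
      exact hS.conj_mem hS n (hn _ (map_mem_normalizer π hnn))
  rw [← hS.2.1]
  exact Subgroup.map_mono h1

theorem IsBigLift.radical {ℓ : ℕ} {G H : Type*} [Group G] [Group H] {π : G →* H}
    (hsurj : Function.Surjective π)
    {S : Subgroup G} {R : Subgroup H} (hS : IsBigLift ℓ π S R) (hR : IsRadicalPSubgroup ℓ R) :
    IsRadicalPSubgroup ℓ S := by
  refine ⟨hS.1, fun P hPN hP hn => hS.2.2 P ?_ hP⟩
  rw [← Subgroup.map_le_iff_le_comap]
  refine hR.2 _ ?_ (hP.map π) ?_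
  · rintro _ ⟨p, hp, rfl⟩
    have := map_mem_normalizer π (hPN hp)
    rwa [hS.2.1] at this
  · intro n hnn
    obtain ⟨g, rfl⟩ := hsurj n
    rintro _ ⟨p, hp, rfl⟩
    exact ⟨_, hn g (hS.mem_normalizer hnn) p hp, by simp⟩

/-- Let `ℓ` be a prime, `G₁` a finite group, and `π : G₁ → H` a surjective homomorphism with
central kernel.  Then `R₁ ↦ π(R₁)` is a bijection from the set of `ℓ`-radical subgroups of `G₁`
onto the set of `ℓ`-radical subgroups of `H`; the inverse sends an `ℓ`-radical subgroup `R` of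
`H` to the unique Sylow `ℓ`-subgroup `O_ℓ(π⁻¹(R))` (i.e. the largest `ℓ`-subgroup) of the
nilpotent group `π⁻¹(R)`; moreover this bijection induces a bijection between conjugacy classes
of `ℓ`-radical subgroups of `G₁` and of `H`. -/
theorem radical_subgroups_central_quotient {ℓ : ℕ} (hℓ : ℓ.Prime)
    {G₁ H : Type*} [Group G₁] [Finite G₁] [Group H]
    (π : G₁ →* H) (hsurj : Function.Surjective π) (hker : π.ker ≤ Subgroup.center G₁) :
    Set.BijOn (fun R₁ : Subgroup G₁ => R₁.map π)
      {R₁ : Subgroup G₁ | IsRadicalPSubgroup ℓ R₁} {R : Subgroup H | IsRadicalPSubgroup ℓ R} ∧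
    (∀ R : Subgroup H, IsRadicalPSubgroup ℓ R →
      ∃ R₁ : Subgroup G₁, IsRadicalPSubgroup ℓ R₁ ∧ R₁.map π = R ∧
        R₁ ≤ R.comap π ∧ IsPGroup ℓ R₁ ∧
        ∀ P : Subgroup G₁, P ≤ R.comap π → IsPGroup ℓ P → P ≤ R₁) ∧
    (∀ R₁ R₂ : Subgroup G₁, IsRadicalPSubgroup ℓ R₁ → IsRadicalPSubgroup ℓ R₂ →
      ((∃ g : G₁, R₁.map (MulAut.conj g).toMonoidHom = R₂) ↔
        (∃ h : H, (R₁.map π).map (MulAut.conj h).toMonoidHom = R₂.map π))) := by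
  refine ⟨⟨fun R hR => hR.map_radical hℓ π hsurj hker, ?_, ?_⟩, ?_, ?_⟩
  · intro R₁ h₁ R₂ h₂ he
    have b₁ := IsRadicalPSubgroup.bigLift hℓ π hsurj hker h₁
    have b₂ := IsRadicalPSubgroup.bigLift hℓ π hsurj hker h₂
    have he' : R₁.map π = R₂.map π := he
    rw [← he'] at b₂
    exact le_antisymm (b₂.2.2 _ (Subgroup.map_le_iff_le_comap.1 b₁.2.1.le) b₁.1)
      (b₁.2.2 _ (Subgroup.map_le_iff_le_comap.1 b₂.2.1.le) b₂.1)
  · intro R hR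
    obtain ⟨S, hS⟩ := exists_bigLift hℓ π hsurj hker R hR.1
    exact ⟨S, hS.radical hsurj hR, hS.2.1⟩
  · intro R hR
    obtain ⟨S, hS⟩ := exists_bigLift hℓ π hsurj hker R hR.1
    exact ⟨S, hS.radical hsurj hR, hS.2.1, Subgroup.map_le_iff_le_comap.1 hS.2.1.le, hS.1, hS.2.2⟩
  · intro R₁ R₂ h₁ h₂
    have b₁ := h₁.bigLift hℓ π hsurj hker
    have b₂ := h₂.bigLift hℓ π hsurj hker
    constructor
    · rintro ⟨g, rfl⟩
      refine ⟨π g, ?_⟩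
      rw [Subgroup.map_map, Subgroup.map_map]
      congr 1
      ext x
      simp
    · rintro ⟨h, hh⟩
      obtain ⟨g, rfl⟩ := hsurj h
      refine ⟨g, le_antisymm ?_ ?_⟩
      · rintro _ ⟨s, hs, rfl⟩
        refine b₁.conj_mem b₂ g ?_ s hs
        intro r hr
        rw [← hh]
        exact ⟨r, hr, rfl⟩
      · intro s hs
        have h3 := b₂.conj_mem b₁ g⁻¹ (by
          intro r hr
          rw [← hh] at hr
          obtain ⟨t, ht, rfl⟩ := hr
          simpa [mul_assoc] using ht) s hs
        exact ⟨_, h3, by simp [mul_assoc]⟩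
end

section
/- Let ℓ be a prime, G̃ a finite group, and π : G̃ → H a surjective group homomorphism whose kernel is contained in the center of G̃. If R̃ is an ℓ-radical subgroup of G̃ and R = π(R̃), then N_H(R) = π(N_{G̃}(R̃)) and N_{G̃}(R̃) = π⁻¹(N_H(R)). -/
/-- Let `ℓ` be a prime, `G₁` a finite group, and `π : G₁ → H` a surjective homomorphism with
central kernel.  If `R₁` is an `ℓ`-radical subgroup of `G₁` and `R = π(R₁)`, then
`N_H(R) = π(N_{G₁}(R₁))` and `N_{G₁}(R₁) = π⁻¹(N_H(R))`. -/
theorem normalizer_radical_central_quotient {ℓ : ℕ} (hℓ : ℓ.Prime)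
    {G₁ H : Type*} [Group G₁] [Finite G₁] [Group H]
    (π : G₁ →* H) (hsurj : Function.Surjective π) (hker : π.ker ≤ Subgroup.center G₁)
    (R₁ : Subgroup G₁) (hrad : IsRadicalPSubgroup ℓ R₁) :
    Subgroup.normalizer (R₁.map π : Set H) = (Subgroup.normalizer (R₁ : Set G₁)).map π ∧
    Subgroup.normalizer (R₁ : Set G₁) = (Subgroup.normalizer (R₁.map π : Set H)).comap π := by
  obtain ⟨hp, hmax⟩ := hrad
  -- central elements of `ℓ`-power order lie in `R₁`
  have hcen : ∀ z ∈ Subgroup.center G₁, ∀ k : ℕ, z ^ ℓ ^ k = 1 → z ∈ R₁ := by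
    intro z hz k hk
    have hcomm : ∀ g : G₁, g * z = z * g := Subgroup.mem_center_iff.mp hz
    refine hmax (Subgroup.zpowers z) ?_ ?_ ?_ (Subgroup.mem_zpowers z)
    · rw [Subgroup.zpowers_le, Subgroup.mem_normalizer_iff]
      intro h
      rw [← hcomm h, mul_inv_cancel_right]
    · rintro ⟨x, n, rfl⟩
      refine ⟨k, Subtype.ext ?_⟩
      change (z ^ n) ^ ℓ ^ k = 1
      rw [← zpow_natCast, ← zpow_mul, mul_comm, zpow_mul, zpow_natCast, hk, one_zpow]
    · rintro n - x ⟨m, rfl⟩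
      have hc : Commute n (z ^ m) := Commute.zpow_right (hcomm n) m
      change n * z ^ m * n⁻¹ ∈ _
      rw [hc.eq, mul_inv_cancel_right]
      exact ⟨m, rfl⟩
  have hpow : ∀ r ∈ R₁, ∃ k : ℕ, r ^ ℓ ^ k = 1 := by
    intro r hr
    obtain ⟨k, hk⟩ := hp ⟨r, hr⟩
    exact ⟨k, congrArg Subtype.val hk⟩
  have key : ∀ g : G₁, π g ∈ Subgroup.normalizer (R₁.map π : Set H) →
      ∀ r ∈ R₁, g * r * g⁻¹ ∈ R₁ := by
    intro g hg r hr
    have h1 : π g * π r * (π g)⁻¹ ∈ R₁.map π :=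
      (Subgroup.mem_normalizer_iff.mp hg (π r)).mp (Subgroup.mem_map_of_mem π hr)
    obtain ⟨s, hs, hse⟩ := h1
    have hz : s⁻¹ * (g * r * g⁻¹) ∈ π.ker := by
      rw [MonoidHom.mem_ker, map_mul, map_inv, hse]
      simp [mul_assoc]
    obtain ⟨a, ha⟩ := hpow r hr
    obtain ⟨b, hb⟩ := hpow s⁻¹ (R₁.inv_mem hs)
    have hzc := Subgroup.mem_center_iff.mp (hker hz)
    have hc : Commute s⁻¹ (g * r * g⁻¹) := by
      have := hzc s⁻¹
      exact mul_left_cancel (this.trans (mul_assoc s⁻¹ (g * r * g⁻¹) s⁻¹))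
    have hzR := hcen _ (hker hz) (a + b) (by
      rw [hc.mul_pow, conj_pow, pow_add]
      rw [mul_comm (ℓ ^ a), pow_mul, hb, one_pow, mul_comm (ℓ ^ b), pow_mul, ha]
      simp)
    have := R₁.mul_mem hs hzR
    rwa [mul_inv_cancel_left] at this
  have hcomap : Subgroup.normalizer (R₁ : Set G₁)
      = (Subgroup.normalizer (R₁.map π : Set H)).comap π := by
    apply le_antisymm
    · rw [← Subgroup.map_le_iff_le_comap]
      exact Subgroup.le_normalizer_map π
    · intro g hg
      have hg' : π g ∈ Subgroup.normalizer (R₁.map π : Set H) := hg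
      rw [Subgroup.mem_normalizer_iff]
      intro h
      refine ⟨key g hg' h, fun hh => ?_⟩
      have := key g⁻¹ (by rw [map_inv]; exact inv_mem hg') _ hh
      simpa [mul_assoc] using this
  refine ⟨?_, hcomap⟩
  rw [hcomap, Subgroup.map_comap_eq_self_of_surjective hsurj]
end
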